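/- arXiv:2508.01445 — 5 statements merged into one kernel-verified Lean document; each statement's English description precedes it below -/
import Mathlib

section
/- Let α ∈ ℝ^N and let f^1, …, f^M : ℝ^N → ℝ be concave functions. If the tuple (β^1, …, β^M) with α·(∑_{i=1}^M β^i) ≤ 1 is Pareto optimal for the separable problem with objectives f^1, …, f^M and constraint vector α, then there exists μ ∈ ℝ^M with μ^i ≥ 0 for all i and ∑_{i=1}^M μ^i = 1 such that (β^1, …, β^M) maximizes ∑_{i=1}^M μ^i f^i(γ^i) over all tuples (γ^1, …, γ^M) with α·(∑_{i=1}^M γ^i) ≤ 1. -/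
open Finset

/-- **Scalarization of weak Pareto optima.** If no point of the convex set `C` strictly improves
all the concave objectives `F i` simultaneously over `x₀`, then `x₀` maximizes a convex
combination of the objectives over `C`. -/
theorem exists_weights_of_forall_not_forall_lt {ι E : Type*} [Fintype ι] [AddCommGroup E]
    [Module ℝ E] {C : Set E} {F : ι → E → ℝ} (hF : ∀ i, ConcaveOn ℝ C (F i)) (hC : Convex ℝ C)
    {x₀ : E} (hx₀ : x₀ ∈ C) (hopt : ∀ x ∈ C, ¬ ∀ i, F i x₀ < F i x) :
    ∃ μ : ι → ℝ, (∀ i, 0 ≤ μ i) ∧ ∑ i, μ i = 1 ∧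
      ∀ x ∈ C, ∑ i, μ i * F i x ≤ ∑ i, μ i * F i x₀ := by
  classical
  let S : Set (ι → ℝ) := ⋃ x ∈ C, Set.univ.pi fun i => Set.Iio (F i x)
  have mem_S {z : ι → ℝ} : z ∈ S ↔ ∃ x ∈ C, ∀ i, z i < F i x := by simp [S]
  have hSopen : IsOpen S :=
    isOpen_biUnion fun x _ => isOpen_set_pi Set.finite_univ fun i _ => isOpen_Iio
  have hSconv : Convex ℝ S := by
    rw [convex_iff_forall_pos]
    intro y hy z hz a b ha hb hab
    obtain ⟨u, hu, hyu⟩ := mem_S.1 hy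
    obtain ⟨v, hv, hzv⟩ := mem_S.1 hz
    refine mem_S.2 ⟨a • u + b • v, hC hu hv ha.le hb.le hab, fun i => ?_⟩
    refine lt_of_lt_of_le ?_ ((hF i).2 hu hv ha.le hb.le hab)
    exact add_lt_add (mul_lt_mul_of_pos_left (hyu i) ha) (mul_lt_mul_of_pos_left (hzv i) hb)
  have hnot : (fun i => F i x₀) ∉ S := fun h => by
    obtain ⟨x, hx, hlt⟩ := mem_S.1 h
    exact hopt x hx hlt
  obtain ⟨φ, hφ⟩ := geometric_hahn_banach_open_point hSconv hSopen hnot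
  let w : ι → ℝ := fun i => φ (Pi.single i 1)
  have φ_eq (z : ι → ℝ) : φ z = ∑ i, w i * z i := by
    conv_lhs => rw [pi_eq_sum_univ' z, map_sum]
    simp only [map_smul, smul_eq_mul, w, mul_comm]
  have hlt {x : E} (hx : x ∈ C) {d : ι → ℝ} (hd : ∀ i, 0 < d i) :
      ∑ i, w i * F i x - ∑ i, w i * d i < ∑ i, w i * F i x₀ := by
    have := hφ (fun i => F i x - d i) (mem_S.2 ⟨x, hx, fun i => sub_lt_self _ (hd i)⟩)
    simpa only [φ_eq, mul_sub, Finset.sum_sub_distrib] using this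
  have hpos : 0 < ∑ i, w i := by
    have := hlt hx₀ (d := fun _ => 1) fun _ => one_pos
    simp only [mul_one] at this
    linarith
  have hnonneg (i : ι) : 0 ≤ w i := by
    by_contra! hi
    have ht : 0 < (∑ j, w j) / -w i := div_pos hpos (neg_pos.2 hi)
    have := hlt hx₀ (d := fun j => 1 + (Pi.single i ((∑ j, w j) / -w i) : ι → ℝ) j) fun j => by
      have : 0 ≤ (Pi.single i ((∑ j, w j) / -w i) : ι → ℝ) j := by
        rw [Pi.single_apply]
        split_ifs <;> linarith
      linarith
    have hw : w i * ((∑ j, w j) / -w i) = -∑ j, w j := by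
      field_simp [hi.ne]
    simp only [mul_add, mul_one, Finset.sum_add_distrib, Pi.single_apply, mul_ite, mul_zero,
      Finset.sum_ite_eq', Finset.mem_univ, if_true, hw] at this
    linarith
  have hmax {x : E} (hx : x ∈ C) : ∑ i, w i * F i x ≤ ∑ i, w i * F i x₀ := by
    refine le_of_forall_pos_le_add fun ε hε => ?_
    have := hlt hx (d := fun _ => ε / ∑ i, w i) fun _ => div_pos hε hpos
    rw [← Finset.sum_mul, mul_div_cancel₀ _ hpos.ne'] at this
    linarith
  refine ⟨fun i => w i / ∑ j, w j, fun i => div_nonneg (hnonneg i) hpos.le, ?_, fun x hx => ?_⟩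
  · rw [← Finset.sum_div, div_self hpos.ne']
  · simp only [div_mul_eq_mul_div, ← Finset.sum_div]
    exact div_le_div_of_nonneg_right (hmax hx) hpos.le

/-- For concave objectives, a Pareto optimal tuple for the separable problem with joint
linear constraint `α·(∑ i, β i) ≤ 1` maximizes some nonnegative weighted sum
(weights summing to 1) of the objectives. -/
theorem pareto_implies_weighted_sum_max_separable {N M : ℕ} [NeZero M]
    (α : Fin N → ℝ) (f : Fin M → (Fin N → ℝ) → ℝ)
    (hconc : ∀ i, ConcaveOn ℝ Set.univ (f i))
    (β : Fin M → Fin N → ℝ) (hβ : ∑ j, α j * (∑ i, β i j) ≤ 1)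
    (hpareto : ¬ ∃ γ : Fin M → Fin N → ℝ, (∑ j, α j * (∑ i, γ i j) ≤ 1) ∧
      (∀ i, f i (β i) ≤ f i (γ i)) ∧ (∃ k, f k (β k) < f k (γ k))) :
    ∃ μ : Fin M → ℝ, (∀ i, 0 ≤ μ i) ∧ (∑ i, μ i = 1) ∧
      ∀ γ : Fin M → Fin N → ℝ, ∑ j, α j * (∑ i, γ i j) ≤ 1 →
        ∑ i, μ i * f i (γ i) ≤ ∑ i, μ i * f i (β i) := by
  let C : Set (Fin M → Fin N → ℝ) := {γ | ∑ j, α j * (∑ i, γ i j) ≤ 1}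
  have hC : Convex ℝ C := by
    refine convex_halfSpace_le (f := fun γ : Fin M → Fin N → ℝ => ∑ j, α j * ∑ i, γ i j)
      ⟨fun γ δ => ?_, fun c γ => ?_⟩ 1
    · simp [Finset.sum_add_distrib, mul_add]
    · simp [Finset.mul_sum, mul_left_comm]
  have hF (i : Fin M) : ConcaveOn ℝ C fun γ => f i (γ i) :=
    ((hconc i).comp_linearMap
      (LinearMap.proj i : (Fin M → Fin N → ℝ) →ₗ[ℝ] Fin N → ℝ)).subset (Set.subset_univ C) hC
  exact exists_weights_of_forall_not_forall_lt hF hC hβ fun γ hγ h =>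
    hpareto ⟨γ, hγ, fun i => (h i).le, 0, h 0⟩
end

section
/- Let T ≥ 1, let α_1, …, α_T ∈ ℝ^N, let β_1, …, β_T ∈ ℝ^N, and suppose u_1, …, u_T ∈ ℝ and λ_1, …, λ_T > 0 satisfy the Afriat inequalities u_s − u_t − λ_t α_t·(β_s − β_t) ≤ 0 for all s, t ∈ {1,…,T}. Define U : ℝ^N → ℝ by U(x) = min_{t ∈ {1,…,T}} [u_t + λ_t α_t·(x − β_t)]. Then U(β_t) = u_t for every t ∈ {1,…,T}. -/
open Finset

/-- If the Afriat inequalities hold, then the reconstructed piecewise-linear utility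
`U(x) = min_t [u_t + λ_t α_t·(x − β_t)]` satisfies `U(β_t) = u_t` for every `t`. -/
theorem afriat_reconstruction_interpolates {N T : ℕ} [NeZero T]
    (α β : Fin T → Fin N → ℝ)
    (u : Fin T → ℝ) (lam : Fin T → ℝ) (hlam : ∀ t, 0 < lam t)
    (hAfriat : ∀ s t : Fin T,
      u s - u t - lam t * (∑ j, α t j * (β s j - β t j)) ≤ 0)
    (U : (Fin N → ℝ) → ℝ)
    (hU : ∀ x, U x = ⨅ t : Fin T, (u t + lam t * ∑ j, α t j * (x j - β t j))) :
    ∀ t : Fin T, U (β t) = u t := by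
  intro t
  rw [hU]
  apply le_antisymm
  · exact (ciInf_le (Set.finite_range _).bddBelow t).trans_eq (by simp)
  · exact le_ciInf fun s => by linarith [hAfriat t s]
end

section
/- Let T ≥ 1, let α_1, …, α_T ∈ ℝ^N, let β_1, …, β_T ∈ ℝ^N, and suppose u_1, …, u_T ∈ ℝ and λ_1, …, λ_T > 0 satisfy the Afriat inequalities u_s − u_t − λ_t α_t·(β_s − β_t) ≤ 0 for all s, t ∈ {1,…,T}. Define U(x) = min_{t ∈ {1,…,T}} [u_t + λ_t α_t·(x − β_t)]. Then for every t ∈ {1,…,T} and every γ ∈ ℝ^N with α_t·γ ≤ α_t·β_t, one has U(γ) ≤ U(β_t); i.e., β_t maximizes U over the budget set {γ : α_t·γ ≤ α_t·β_t}. -/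
open Finset

/-- If the Afriat inequalities hold, then each observed response `β_t` maximizes the
reconstructed utility `U(x) = min_s [u_s + λ_s α_s·(x − β_s)]` over the budget set
`{γ : α_t·γ ≤ α_t·β_t}`. -/
theorem afriat_reconstruction_rationalizes {N T : ℕ} [NeZero T]
    (α β : Fin T → Fin N → ℝ)
    (u : Fin T → ℝ) (lam : Fin T → ℝ) (hlam : ∀ t, 0 < lam t)
    (hAfriat : ∀ s t : Fin T,
      u s - u t - lam t * (∑ j, α t j * (β s j - β t j)) ≤ 0)
    (U : (Fin N → ℝ) → ℝ)
    (hU : ∀ x, U x = ⨅ t : Fin T, (u t + lam t * ∑ j, α t j * (x j - β t j))) :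
    ∀ t : Fin T, ∀ γ : Fin N → ℝ,
      (∑ j, α t j * γ j) ≤ (∑ j, α t j * β t j) → U γ ≤ U (β t) := by
  intro t γ hγ
  rw [hU, hU]
  have hbudget : ∑ j, α t j * (γ j - β t j) ≤ 0 := by
    simpa only [mul_sub, Finset.sum_sub_distrib, sub_nonpos] using hγ
  calc ⨅ s, (u s + lam s * ∑ j, α s j * (γ j - β s j))
      ≤ u t + lam t * ∑ j, α t j * (γ j - β t j) :=
        ciInf_le (Set.finite_range _).bddBelow t
    _ ≤ u t := by
        linarith [mul_nonpos_of_nonneg_of_nonpos (hlam t).le hbudget]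
    _ ≤ ⨅ s, (u s + lam s * ∑ j, α s j * (β t j - β s j)) :=
        le_ciInf fun s => by linarith [hAfriat t s]
end

section
/- Let T, M ≥ 1, let α_1, …, α_T ∈ ℝ^N, and for each agent i ∈ {1,…,M} let β_t^i ∈ ℝ^N for t ∈ {1,…,T}. Suppose for each i there exist u_t^i ∈ ℝ and λ_t^i > 0 satisfying the Afriat inequalities u_s^i − u_t^i − λ_t^i α_t·(β_s^i − β_t^i) ≤ 0 for all s, t ∈ {1,…,T}. Define U^i(x) = min_{t ∈ {1,…,T}} [u_t^i + λ_t^i α_t·(x − β_t^i)]. Then for every t ∈ {1,…,T}, the tuple (β_t^1, …, β_t^M) is Pareto optimal for the separable problem with objectives U^1, …, U^M under the constraint α_t·(∑_{i=1}^M γ^i) ≤ α_t·(∑_{i=1}^M β_t^i): there is no tuple (γ^1, …, γ^M) with α_t·(∑_{i=1}^M γ^i) ≤ α_t·(∑_{i=1}^M β_t^i) such that U^i(γ^i) ≥ U^i(β_t^i) for all i and U^k(γ^k) > U^k(β_t^k) for some k. -/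
open Finset

/-- Under the Afriat inequalities, the reconstructed utility of the observed bundle `β t` is at
least `u t`. -/
theorem le_afriat_utility {ι κ : Type*} [Nonempty ι] [Fintype κ]
    (α β : ι → κ → ℝ) (u lam : ι → ℝ)
    (h : ∀ s t, u s - u t - lam t * (∑ j, α t j * (β s j - β t j)) ≤ 0) (t : ι) :
    u t ≤ ⨅ s, (u s + lam s * ∑ j, α s j * (β t j - β s j)) :=
  le_ciInf fun s => by linarith [h t s]

/-- If each agent's data satisfies the Afriat inequalities, then at each time `t` the
observed tuple of responses is Pareto optimal for the separable problem with the
reconstructed utilities `U^i` under the joint budget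
`α_t·(∑ i, γ^i) ≤ α_t·(∑ i, β_t^i)`. -/
theorem afriat_multiagent_pareto {N T M : ℕ} [NeZero T] [NeZero M]
    (α : Fin T → Fin N → ℝ) (β : Fin T → Fin M → Fin N → ℝ)
    (u : Fin M → Fin T → ℝ) (lam : Fin M → Fin T → ℝ)
    (hlam : ∀ i t, 0 < lam i t)
    (hAfriat : ∀ i : Fin M, ∀ s t : Fin T,
      u i s - u i t - lam i t * (∑ j, α t j * (β s i j - β t i j)) ≤ 0)
    (U : Fin M → (Fin N → ℝ) → ℝ)
    (hU : ∀ i x, U i x = ⨅ t : Fin T, (u i t + lam i t * ∑ j, α t j * (x j - β t i j))) :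
    ∀ t : Fin T, ¬ ∃ γ : Fin M → Fin N → ℝ,
      (∑ j, α t j * (∑ i, γ i j)) ≤ (∑ j, α t j * (∑ i, β t i j)) ∧
      (∀ i, U i (β t i) ≤ U i (γ i)) ∧ (∃ k, U k (β t k) < U k (γ k)) := by
  rintro t ⟨γ, hbudget, hle, k, hlt⟩
  have hlower (i) : u i t ≤ U i (β t i) := by
    rw [hU]
    exact le_afriat_utility α (fun s => β s i) (u i) (lam i) (hAfriat i) t
  have hupper (i) : U i (γ i) ≤ u i t + lam i t * ∑ j, α t j * (γ i j - β t i j) := by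
    rw [hU]
    exact ciInf_le (Set.finite_range _).bddBelow t
  have hnonneg (i) : 0 ≤ ∑ j, α t j * (γ i j - β t i j) :=
    nonneg_of_mul_nonneg_right (by linarith [hlower i, hupper i, hle i]) (hlam i t)
  have hpos : 0 < ∑ j, α t j * (γ k j - β t k j) :=
    pos_of_mul_pos_right (by linarith [hlower k, hupper k]) (hlam k t).le
  have hsum : 0 < ∑ i, ∑ j, α t j * (γ i j - β t i j) :=
    sum_pos' (fun i _ => hnonneg i) ⟨k, mem_univ k, hpos⟩
  rw [sum_comm] at hsum
  simp only [← mul_sum, sum_sub_distrib, mul_sub] at hsum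
  linarith
end

section
/- Let T, M ≥ 1, let α_1, …, α_T ∈ ℝ^N each have strictly positive entries, and for each i ∈ {1,…,M} let β_t^i ∈ ℝ^N for t ∈ {1,…,T}. Let U^1, …, U^M : ℝ^N → ℝ be concave, continuous functions, each strictly monotone increasing in the sense that x ≤ y componentwise with x ≠ y implies U^i(x) < U^i(y), and let μ ∈ ℝ^M with μ^i > 0 for all i and ∑_{i=1}^M μ^i = 1. Suppose for every t ∈ {1,…,T} the tuple (β_t^1, …, β_t^M) maximizes ∑_{i=1}^M μ^i U^i(γ^i) over all tuples (γ^1, …, γ^M) with α_t·(∑_{i=1}^M γ^i) ≤ α_t·(∑_{i=1}^M β_t^i). Then for each i ∈ {1,…,M} there exist numbers u_t^i ∈ ℝ and λ_t^i > 0 such that u_s^i − u_t^i − λ_t^i α_t·(β_s^i − β_t^i) ≤ 0 for all s, t ∈ {1,…,T}. -/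
open Finset

/-- A maximizer `b` of a concave function over a half-space `{x | ℓ x ≤ ℓ b}` admits a
supergradient that is a multiple of `ℓ`. -/
theorem ConcaveOn.exists_smul_supergradient_of_forall_le {E : Type*} [AddCommGroup E] [Module ℝ E]
    {f : E → ℝ} (hf : ConcaveOn ℝ Set.univ f) (ℓ : E →ₗ[ℝ] ℝ) {b v : E} (hv : 0 < ℓ v)
    (hmax : ∀ x, ℓ x ≤ ℓ b → f x ≤ f b) :
    ∃ c : ℝ, ∀ x, f x ≤ f b + c * ℓ (x - b) := by
  obtain ⟨c, hc_upper, hc_lower⟩ := exists_between_of_forall_le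
    (s := (fun y ↦ (f y - f b) / ℓ (y - b)) '' {y | 0 < ℓ (y - b)})
    (t := (fun x ↦ (f b - f x) / ℓ (b - x)) '' {x | 0 < ℓ (b - x)})
    (Set.Nonempty.image _ ⟨b + v, by simpa using hv⟩)
    (Set.Nonempty.image _ ⟨b - v, by simpa using hv⟩) (by
      rintro _ ⟨y, hy, rfl⟩ _ ⟨x, hx, rfl⟩
      simp only [Set.mem_ofPred_eq, map_sub] at hx hy ⊢
      have hd : 0 < ℓ y - ℓ x := by linarith
      have hconc := hf.2 (Set.mem_univ y) (Set.mem_univ x)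
        (div_nonneg hx.le hd.le) (div_nonneg hy.le hd.le) (by field_simp; ring)
      have hle := hconc.trans (hmax _ (by
        simp only [map_add, map_smul, smul_eq_mul]
        apply le_of_eq
        field_simp
        ring))
      simp only [smul_eq_mul] at hle
      have hmul : (ℓ b - ℓ x) * f y + (ℓ y - ℓ b) * f x ≤ f b * (ℓ y - ℓ x) := by
        rw [← div_le_iff₀ hd]
        convert hle using 1
        ring
      rw [div_le_div_iff₀ hy hx]
      linarith)
  refine ⟨c, fun x ↦ ?_⟩
  rcases lt_trichotomy (ℓ (x - b)) 0 with h | h | h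
  · have hx : 0 < ℓ (b - x) := by rw [← neg_sub x b, map_neg]; linarith
    have hle := hc_lower (Set.mem_image_of_mem _ hx)
    rw [le_div_iff₀ hx, ← neg_sub x b, map_neg] at hle
    linarith
  · have hx := hmax x (by rw [map_sub] at h; linarith)
    simpa [h] using hx
  · have hle := hc_upper (Set.mem_image_of_mem _ h)
    rw [div_le_iff₀ h] at hle
    linarith

/-- If the observed multi-agent data arises at each time from maximizing a strictly
positively weighted sum of concave, continuous, strictly increasing utilities under
the joint budget constraint, then each agent's data admits Afriat witnesses. -/
theorem collective_rationality_implies_afriat {N T M : ℕ} [NeZero T] [NeZero M]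
    (α : Fin T → Fin N → ℝ) (hα : ∀ t j, 0 < α t j)
    (β : Fin T → Fin M → Fin N → ℝ)
    (U : Fin M → (Fin N → ℝ) → ℝ)
    (hconc : ∀ i, ConcaveOn ℝ Set.univ (U i))
    (hcont : ∀ i, Continuous (U i))
    (hmono : ∀ i, ∀ x y : Fin N → ℝ, x ≤ y → x ≠ y → U i x < U i y)
    (μ : Fin M → ℝ) (hμpos : ∀ i, 0 < μ i) (hμsum : ∑ i, μ i = 1)
    (hmax : ∀ t : Fin T, ∀ γ : Fin M → Fin N → ℝ,
      (∑ j, α t j * (∑ i, γ i j)) ≤ (∑ j, α t j * (∑ i, β t i j)) →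
      ∑ i, μ i * U i (γ i) ≤ ∑ i, μ i * U i (β t i)) :
    ∀ i : Fin M, ∃ u : Fin T → ℝ, ∃ lam : Fin T → ℝ, (∀ t, 0 < lam t) ∧
      ∀ s t : Fin T, u s - u t - lam t * (∑ j, α t j * (β s i j - β t i j)) ≤ 0 := by
  intro i
  rcases Nat.eq_zero_or_pos N with rfl | hN
  · exact ⟨fun _ ↦ 0, fun _ ↦ 1, fun _ ↦ one_pos, by simp⟩
  have : Nonempty (Fin N) := ⟨⟨0, hN⟩⟩
  let ℓ : Fin T → (Fin N → ℝ) →ₗ[ℝ] ℝ := fun t ↦ ∑ j, α t j • LinearMap.proj j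
  have hℓ : ∀ t x, ℓ t x = ∑ j, α t j * x j := fun t x ↦ by simp [ℓ]
  have hv : ∀ t, 0 < ℓ t 1 := fun t ↦ by
    simpa [hℓ] using Finset.sum_pos (fun j _ ↦ hα t j) Finset.univ_nonempty
  have hagent : ∀ t x, ℓ t x ≤ ℓ t (β t i) → U i x ≤ U i (β t i) := by
    intro t x hx
    have hbudget : ∀ γ : Fin M → Fin N → ℝ,
        ∑ j, α t j * ∑ k, γ k j = ∑ k, ℓ t (γ k) := fun γ ↦ by
      simp only [hℓ, Finset.mul_sum]
      exact Finset.sum_comm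
    have hle := hmax t (Function.update (β t) i x) (by
      rw [hbudget, hbudget]
      refine Finset.sum_le_sum fun k _ ↦ ?_
      obtain rfl | hk := eq_or_ne k i
      · simpa using hx
      · simp [hk])
    rw [← Finset.add_sum_erase _ _ (Finset.mem_univ i),
      ← Finset.add_sum_erase _ (fun k ↦ μ k * U k (β t k)) (Finset.mem_univ i),
      Finset.sum_congr rfl (g := fun k ↦ μ k * U k (β t k)) fun k hk ↦ by
        rw [Function.update_of_ne (Finset.ne_of_mem_erase hk)]] at hle
    rw [Function.update_self, add_le_add_iff_right] at hle
    exact le_of_mul_le_mul_left hle (hμpos i)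
  choose lam hlam using fun t ↦
    (hconc i).exists_smul_supergradient_of_forall_le (ℓ t) (hv t) (hagent t)
  refine ⟨fun t ↦ U i (β t i), lam, fun t ↦ ?_, fun s t ↦ ?_⟩
  · have hlt := hmono i (β t i) (β t i + 1) (by simp) (by simp)
    have hle := hlam t (β t i + 1)
    rw [add_sub_cancel_left] at hle
    exact pos_of_mul_pos_left (by linarith) (hv t).le
  · have hle := hlam t (β s i)
    rw [hℓ] at hle
    simp only [Pi.sub_apply] at hle
    linarith
end
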